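/- arXiv:hep-th/9806084 — 2 statements merged into one kernel-verified Lean document; each statement's English description precedes it below -/
import Mathlib

section
/- Fix 1 ≤ n < N and a constant unitary U ∈ U(N). Let Z : M^{1+m} → M(N−n,n;ℂ) be smooth and P := U P_0(Z) U†. Then pointwise the Lagrangian density satisfies (1/2) tr(∂_μP ∂^μP) = tr[ (I + Z†Z)^{-1} ∂^μZ† (I' + ZZ†)^{-1} ∂_μZ ], where I = I_n, I' = I_{N−n}, and repeated μ indices denote Minkowski contraction. -/
/-!
`(1+m)`-dimensional Minkowski space `M^{1+m}` is modeled as `Fin (m+1) → ℝ` with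
coordinates `x 0, x 1, ..., x m` and metric `η = diag(1, -1, ..., -1)`.
`pd μ f` is the partial derivative `∂_μ f`, `pdM` its entrywise matrix version,
`boxS`/`boxM` the d'Alembertian `□ = ∂_0² - Σ_{k=1}^m ∂_k²`, and contractions over a
repeated index `μ` are written as `∑ μ, eta μ * ⋯` (resp. `eta μ • ⋯`).
-/

noncomputable section
open Matrix
open scoped Kronecker

/-- `(1+m)`-dimensional Minkowski spacetime. -/
abbrev Spacetime (m : ℕ) := Fin (m + 1) → ℝ

/-- Partial derivative `∂_μ`. -/
def pd {m : ℕ} {E : Type*} [NormedAddCommGroup E] [NormedSpace ℝ E]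
    (μ : Fin (m + 1)) (f : Spacetime m → E) : Spacetime m → E :=
  fun x => fderiv ℝ f x (Pi.single μ 1)

/-- Entrywise partial derivative `∂_μ` of a matrix-valued function. -/
def pdM {m : ℕ} {ι κ : Type*} (μ : Fin (m + 1)) (P : Spacetime m → Matrix ι κ ℂ) :
    Spacetime m → Matrix ι κ ℂ :=
  fun x => Matrix.of fun i j => pd μ (fun y => P y i j) x

/-- The Minkowski signature `η = diag(1, -1, …, -1)` as a complex scalar:
raising an index costs `eta μ`. -/
def eta {m : ℕ} (μ : Fin (m + 1)) : ℂ := if μ = 0 then 1 else -1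

/-- d'Alembertian `□ = ∂^μ∂_μ` on scalar functions. -/
def boxS {m : ℕ} (f : Spacetime m → ℂ) : Spacetime m → ℂ :=
  fun x => ∑ μ, eta μ * pd μ (pd μ f) x

/-- d'Alembertian `□ = ∂^μ∂_μ` on matrix-valued functions. -/
def boxM {m : ℕ} {ι κ : Type*} (P : Spacetime m → Matrix ι κ ℂ) :
    Spacetime m → Matrix ι κ ℂ :=
  fun x => ∑ μ, eta μ • pdM μ (pdM μ P) x

/-- The block matrix `V(Z) = [[I, -Z†],[Z, I]]` on `ℂ^n ⊕ ℂ^p`. -/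
def Vmat {n p : ℕ} (Z : Matrix (Fin p) (Fin n) ℂ) :
    Matrix (Fin n ⊕ Fin p) (Fin n ⊕ Fin p) ℂ :=
  Matrix.fromBlocks 1 (-Zᴴ) Z 1

/-- The block matrix `W(Z) = [[I, Z†],[-Z, I]]` on `ℂ^n ⊕ ℂ^p`. -/
def Wmat {n p : ℕ} (Z : Matrix (Fin p) (Fin n) ℂ) :
    Matrix (Fin n ⊕ Fin p) (Fin n ⊕ Fin p) ℂ :=
  Matrix.fromBlocks 1 Zᴴ (-Z) 1

/-- The projector `P₀(Z) = V(Z) · diag(I_n, 0_p) · V(Z)⁻¹`. -/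
def P0 {n p : ℕ} (Z : Matrix (Fin p) (Fin n) ℂ) :
    Matrix (Fin n ⊕ Fin p) (Fin n ⊕ Fin p) ℂ :=
  Vmat Z * Matrix.fromBlocks 1 0 0 0 * (Vmat Z)⁻¹

section helpers

open Matrix
open scoped ComplexOrder

/-- Entrywise differentiability of a matrix-valued function. -/
def DM {m : ℕ} {ι κ : Type*} (A : Spacetime m → Matrix ι κ ℂ) (x : Spacetime m) : Prop :=
  ∀ i j, DifferentiableAt ℝ (fun y => A y i j) x

theorem DM.mul {m : ℕ} {ι κ l : Type*} [Fintype κ] {A : Spacetime m → Matrix ι κ ℂ}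
    {B : Spacetime m → Matrix κ l ℂ} {x : Spacetime m} (hA : DM A x) (hB : DM B x) :
    DM (fun y => A y * B y) x := by
  intro i j
  simp only [Matrix.mul_apply]
  exact DifferentiableAt.fun_sum fun k _ => (hA i k).mul (hB k j)

theorem DM.const {m : ℕ} {ι κ : Type*} (A : Matrix ι κ ℂ) (x : Spacetime m) :
    DM (fun _ => A) x := fun _ _ => differentiableAt_const _

theorem pdM_mul {m : ℕ} {ι κ l : Type*} [Fintype κ] {A : Spacetime m → Matrix ι κ ℂ}
    {B : Spacetime m → Matrix κ l ℂ} {x : Spacetime m} (hA : DM A x) (hB : DM B x)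
    (μ : Fin (m + 1)) :
    pdM μ (fun y => A y * B y) x = pdM μ A x * B x + A x * pdM μ B x := by
  ext i j
  simp only [pdM, pd, Matrix.mul_apply, Matrix.of_apply, Matrix.add_apply]
  rw [fderiv_fun_sum fun k _ => (hA i k).fun_mul (hB k j), ContinuousLinearMap.sum_apply,
    ← Finset.sum_add_distrib]
  refine Finset.sum_congr rfl fun k _ => ?_
  rw [fderiv_fun_mul (hA i k) (hB k j)]
  simp only [ContinuousLinearMap.add_apply, ContinuousLinearMap.smul_apply, smul_eq_mul]
  ring

theorem pdM_const {m : ℕ} {ι κ : Type*} (A : Matrix ι κ ℂ) (x : Spacetime m)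
    (μ : Fin (m + 1)) : pdM μ (fun _ => A) x = 0 := by
  ext i j
  simp [pdM, pd]

theorem diff_prod {m : ℕ} {ι : Type*} (s : Finset ι) {f : ι → Spacetime m → ℂ}
    {x : Spacetime m} (hf : ∀ i, DifferentiableAt ℝ (f i) x) :
    DifferentiableAt ℝ (fun y => ∏ i ∈ s, f i y) x := by
  classical
  induction s using Finset.induction_on with
  | empty => simp
  | insert i s hi ih =>
    simp only [Finset.prod_insert hi]
    exact (hf i).mul ih

theorem DM.det {m : ℕ} {ι : Type*} [Fintype ι] [DecidableEq ι]
    {A : Spacetime m → Matrix ι ι ℂ} {x : Spacetime m} (hA : DM A x) :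
    DifferentiableAt ℝ (fun y => (A y).det) x := by
  simp only [Matrix.det_apply']
  refine DifferentiableAt.fun_sum fun σ _ => ?_
  exact (differentiableAt_const _).mul
    (diff_prod Finset.univ fun i => hA (σ i) i)

theorem DM.inv {m : ℕ} {ι : Type*} [Fintype ι] [DecidableEq ι]
    {A : Spacetime m → Matrix ι ι ℂ} {x : Spacetime m} (hA : DM A x)
    (h : (A x).det ≠ 0) : DM (fun y => (A y)⁻¹) x := by
  intro i j
  simp only [Matrix.inv_def, Ring.inverse_eq_inv', Matrix.smul_apply, smul_eq_mul,
    Matrix.adjugate_apply]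
  refine (hA.det.inv h).mul (DM.det ?_)
  intro k l
  by_cases hk : k = j
  · subst hk
    simp
  · simp only [Matrix.updateRow_ne hk]
    exact hA k l

theorem isUnit_a {n p : ℕ} (Z : Matrix (Fin p) (Fin n) ℂ) : IsUnit (1 + Zᴴ * Z).det :=
  (Matrix.isUnit_iff_isUnit_det _).1
    (Matrix.PosDef.one.add_posSemidef (Matrix.posSemidef_conjTranspose_mul_self Z)).isUnit

theorem isUnit_b {n p : ℕ} (Z : Matrix (Fin p) (Fin n) ℂ) : IsUnit (1 + Z * Zᴴ).det :=
  (Matrix.isUnit_iff_isUnit_det _).1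
    (Matrix.PosDef.one.add_posSemidef (Matrix.posSemidef_self_mul_conjTranspose Z)).isUnit

theorem leftInv {n p : ℕ} (Z : Matrix (Fin p) (Fin n) ℂ) :
    (Matrix.fromBlocks (1 + Zᴴ * Z)⁻¹ 0 0 (1 + Z * Zᴴ)⁻¹ * Wmat Z) * Vmat Z = 1 := by
  rw [Matrix.mul_assoc]
  have : Wmat Z * Vmat Z = Matrix.fromBlocks (1 + Zᴴ * Z) 0 0 (1 + Z * Zᴴ) := by
    simp [Wmat, Vmat, Matrix.fromBlocks_multiply, add_comm]
  rw [this]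
  simp [Matrix.fromBlocks_multiply, Matrix.nonsing_inv_mul _ (isUnit_a Z),
    Matrix.nonsing_inv_mul _ (isUnit_b Z)]

theorem Vinv {n p : ℕ} (Z : Matrix (Fin p) (Fin n) ℂ) :
    (Vmat Z)⁻¹ = Matrix.fromBlocks (1 + Zᴴ * Z)⁻¹ 0 0 (1 + Z * Zᴴ)⁻¹ * Wmat Z :=
  Matrix.inv_eq_left_inv (leftInv Z)

theorem Vunit {n p : ℕ} (Z : Matrix (Fin p) (Fin n) ℂ) : IsUnit (Vmat Z).det :=
  Matrix.isUnit_det_of_left_inverse (leftInv Z)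

theorem DM.V {m n p : ℕ} {Z : Spacetime m → Matrix (Fin p) (Fin n) ℂ} {x : Spacetime m}
    (hZ : DM Z x) : DM (fun y => Vmat (Z y)) x := by
  rintro (i | i) (j | j)
  · simp [Vmat]
  · simpa [Vmat] using (hZ j i).star.neg
  · simpa [Vmat] using hZ i j
  · simp [Vmat]

theorem pdM_V {m n p : ℕ} {Z : Spacetime m → Matrix (Fin p) (Fin n) ℂ} {x : Spacetime m}
    (hZ : DM Z x) (μ : Fin (m + 1)) :
    pdM μ (fun y => Vmat (Z y)) x
      = Matrix.fromBlocks 0 (-(pdM μ Z x)ᴴ) (pdM μ Z x) 0 := by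
  ext i j
  rcases i with i | i <;> rcases j with j | j
  · simp [Vmat, pdM, pd]
  · have h := (hZ j i).hasFDerivAt.star.neg.fderiv
    simp only [Vmat, pdM, pd, Matrix.of_apply, Matrix.fromBlocks_apply₁₂, Matrix.neg_apply,
      Matrix.conjTranspose_apply]
    erw [h]
    simp
  · simp [Vmat, pdM, pd]
  · simp [Vmat, pdM, pd]

theorem key {m n p : ℕ} {Z : Spacetime m → Matrix (Fin p) (Fin n) ℂ} {x : Spacetime m}
    (hZ : DM Z x) (μ : Fin (m + 1)) :
    DM (fun y => P0 (Z y)) x ∧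
    Matrix.trace (pdM μ (fun y => P0 (Z y)) x * pdM μ (fun y => P0 (Z y)) x)
      = 2 * Matrix.trace
          ((1 + (Z x)ᴴ * Z x)⁻¹ * (pdM μ Z x)ᴴ * (1 + Z x * (Z x)ᴴ)⁻¹ * pdM μ Z x) := by
  have hV := hZ.V
  have hVu := Vunit (Z x)
  set E : Matrix (Fin n ⊕ Fin p) (Fin n ⊕ Fin p) ℂ := Matrix.fromBlocks 1 0 0 0 with hE
  have hP : DM (fun y => P0 (Z y)) x :=
    (hV.mul (DM.const E x)).mul (hV.inv hVu.ne_zero)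
  refine ⟨hP, ?_⟩
  have hPV : (fun y => P0 (Z y) * Vmat (Z y)) = fun y => Vmat (Z y) * E := by
    funext y
    rw [P0, Matrix.mul_assoc, Matrix.nonsing_inv_mul _ (Vunit (Z y)), Matrix.mul_one]
  have h1 := pdM_mul hP hV μ
  rw [hPV, pdM_mul hV (DM.const E x) μ, pdM_const, Matrix.mul_zero, add_zero, pdM_V hZ] at h1
  set D := pdM μ (fun y => P0 (Z y)) x
  set V := Vmat (Z x) with hVdef
  set dZ := pdM μ Z x
  set a := (1 + (Z x)ᴴ * Z x)⁻¹ with ha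
  set b := (1 + Z x * (Z x)ᴴ)⁻¹ with hb
  set dV : Matrix (Fin n ⊕ Fin p) (Fin n ⊕ Fin p) ℂ := Matrix.fromBlocks 0 (-dZᴴ) dZ 0 with hdV
  have hl : V⁻¹ * V = 1 := Matrix.nonsing_inv_mul _ hVu
  have hr : V * V⁻¹ = 1 := Matrix.mul_nonsing_inv _ hVu
  have hX : V⁻¹ * dV = Matrix.fromBlocks (a * ((Z x)ᴴ * dZ)) (-(a * dZᴴ)) (b * dZ)
      (b * (Z x * dZᴴ)) := by
    rw [hVdef, Vinv, Matrix.mul_assoc, Wmat, hdV]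
    simp [Matrix.fromBlocks_multiply]
    exact ⟨rfl, rfl, rfl, rfl⟩
  have hD : V⁻¹ * D * V = Matrix.fromBlocks 0 (a * dZᴴ) (b * dZ) 0 := by
    have : D * V = dV * E - P0 (Z x) * dV := by rw [h1]; abel
    have h3 : V⁻¹ * P0 (Z x) = E * V⁻¹ := by
      rw [P0, ← Matrix.mul_assoc, ← Matrix.mul_assoc, hl, Matrix.one_mul]
    rw [Matrix.mul_assoc, this, Matrix.mul_sub, ← Matrix.mul_assoc, ← Matrix.mul_assoc, h3,
      Matrix.mul_assoc E, hX, hE]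
    simp [Matrix.fromBlocks_multiply, sub_eq_add_neg, Matrix.fromBlocks_neg,
      Matrix.fromBlocks_add]
  have ht : Matrix.trace (D * D) = Matrix.trace ((V⁻¹ * D * V) * (V⁻¹ * D * V)) := by
    have : (V⁻¹ * D * V) * (V⁻¹ * D * V) = V⁻¹ * (D * D * V) := by
      calc _ = V⁻¹ * D * (V * V⁻¹) * D * V := by simp only [Matrix.mul_assoc]
        _ = _ := by rw [hr]; simp only [Matrix.mul_assoc, Matrix.one_mul]
    rw [this, Matrix.trace_mul_comm V⁻¹, Matrix.mul_assoc (D * D), hr, Matrix.mul_one]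
  rw [ht, hD, Matrix.fromBlocks_multiply, Matrix.trace, Fintype.sum_sum_type]
  simp only [Matrix.diag_apply, Matrix.fromBlocks_apply₁₁, Matrix.fromBlocks_apply₂₂]
  change Matrix.trace _ + Matrix.trace _ = 2 * Matrix.trace _
  simp only [Matrix.zero_mul, Matrix.mul_zero, zero_add, add_zero]
  rw [Matrix.trace_mul_comm (b * dZ), two_mul]
  simp only [Matrix.mul_assoc]

end helpers

/-- For `P = U P₀(Z) U†` with `U` a constant unitary and `Z` smooth,
`(1/2) tr(∂_μP ∂^μP) = tr[(I + Z†Z)⁻¹ ∂^μZ† (I' + ZZ†)⁻¹ ∂_μZ]` pointwise. -/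
theorem statement6 {m n p : ℕ} (hn : 0 < n) (hp : 0 < p)
    (U : Matrix (Fin n ⊕ Fin p) (Fin n ⊕ Fin p) ℂ)
    (hU : U ∈ Matrix.unitaryGroup (Fin n ⊕ Fin p) ℂ)
    (Z : Spacetime m → Matrix (Fin p) (Fin n) ℂ)
    (hZ : ∀ i j, ContDiff ℝ (⊤ : ℕ∞) fun x => Z x i j)
    (P : Spacetime m → Matrix (Fin n ⊕ Fin p) (Fin n ⊕ Fin p) ℂ)
    (hP : ∀ x, P x = U * P0 (Z x) * Uᴴ) :
    ∀ x, (1 / 2 : ℂ) * ∑ μ, eta μ * Matrix.trace (pdM μ P x * pdM μ P x)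
      = ∑ μ, eta μ * Matrix.trace
          ((1 + (Z x)ᴴ * Z x)⁻¹ * (pdM μ Z x)ᴴ * (1 + Z x * (Z x)ᴴ)⁻¹ * pdM μ Z x) := by
  intro x
  have hD : DM Z x := fun i j => ((hZ i j).differentiable (by simp)).differentiableAt
  have hU' : Uᴴ * U = 1 := (Matrix.mem_unitaryGroup_iff').1 hU
  rw [Finset.mul_sum]
  refine Finset.sum_congr rfl fun μ _ => ?_
  obtain ⟨hP0, hk⟩ := key hD μ
  have hPe : P = fun y => U * P0 (Z y) * Uᴴ := funext hP
  have hdP : pdM μ P x = U * pdM μ (fun y => P0 (Z y)) x * Uᴴ := by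
    rw [hPe, pdM_mul ((DM.const U x).mul hP0) (DM.const Uᴴ x), pdM_mul (DM.const U x) hP0,
      pdM_const, pdM_const]
    simp
  have ht : Matrix.trace (pdM μ P x * pdM μ P x)
      = Matrix.trace (pdM μ (fun y => P0 (Z y)) x * pdM μ (fun y => P0 (Z y)) x) := by
    rw [hdP]
    set D := pdM μ (fun y => P0 (Z y)) x
    have : (U * D * Uᴴ) * (U * D * Uᴴ) = U * (D * D * Uᴴ) := by
      calc _ = U * D * (Uᴴ * U) * D * Uᴴ := by simp only [Matrix.mul_assoc]
        _ = _ := by rw [hU']; simp only [Matrix.mul_assoc, Matrix.one_mul]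
    rw [this, Matrix.trace_mul_comm, Matrix.mul_assoc, hU', Matrix.mul_one]
  rw [ht, hk]
  ring
end
end

section
/- Let u : M^{1+m} → ℂ be smooth with □u = 0 and ∂^μu ∂_μu = 0, and set P := (1/(1+|u|²)) · [[1, ū],[u, |u|²]]. Then P satisfies the ℂP¹ submodel equations [P, □P] = 0 and [P, ∂_μP] ⊗ ∂^μP + ∂^μP ⊗ [P, ∂_μP] = 0, where ⊗ is the Kronecker product of 2×2 matrices. -/
/-!
`(1+m)`-dimensional Minkowski space `M^{1+m}` is modeled as `Fin (m+1) → ℝ` with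
coordinates `x 0, x 1, ..., x m` and metric `η = diag(1, -1, ..., -1)`.
`pd μ f` is the partial derivative `∂_μ f`, `pdM` its entrywise matrix version,
`boxS`/`boxM` the d'Alembertian `□ = ∂_0² - Σ_{k=1}^m ∂_k²`, and contractions over a
repeated index `μ` are written as `∑ μ, eta μ * ⋯` (resp. `eta μ • ⋯`).
-/

noncomputable section
open Matrix
open scoped Kronecker

section helpers
variable {m : ℕ} (μ : Fin (m + 1)) {f g : Spacetime m → ℂ} (x : Spacetime m)

lemma pd_add' (hf : DifferentiableAt ℝ f x) (hg : DifferentiableAt ℝ g x) :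
    pd μ (fun y => f y + g y) x = pd μ f x + pd μ g x := by
  unfold pd; rw [fderiv_fun_add hf hg]; rfl

lemma pd_sub' (hf : DifferentiableAt ℝ f x) (hg : DifferentiableAt ℝ g x) :
    pd μ (fun y => f y - g y) x = pd μ f x - pd μ g x := by
  unfold pd; rw [fderiv_fun_sub hf hg]; rfl

lemma pd_mul' (hf : DifferentiableAt ℝ f x) (hg : DifferentiableAt ℝ g x) :
    pd μ (fun y => f y * g y) x = pd μ f x * g x + f x * pd μ g x := by
  unfold pd; rw [fderiv_fun_mul hf hg]; simp; ring

lemma pd_const' (c : ℂ) : pd μ (fun _ : Spacetime m => c) x = 0 := by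
  unfold pd; simp

/-- Quotient rule, derived from the product rule. -/
lemma pd_div' (hf : DifferentiableAt ℝ f x) (hg : DifferentiableAt ℝ g x)
    (h0 : ∀ y, g y ≠ 0) :
    pd μ (fun y => f y / g y) x = (pd μ f x * g x - f x * pd μ g x) / g x ^ 2 := by
  have hd : DifferentiableAt ℝ (fun y => f y / g y) x := by
    simp only [div_eq_mul_inv]
    exact hf.mul (hg.inv (h0 x))
  have h := pd_mul' μ x hd hg
  have e : (fun y => f y / g y * g y) = f := by
    funext y; exact div_mul_cancel₀ _ (h0 y)
  rw [e] at h
  have := h0 x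
  rw [h]
  field_simp
  ring

lemma pd_conj' (hf : DifferentiableAt ℝ f x) :
    pd μ (fun y => (starRingEnd ℂ) (f y)) x = (starRingEnd ℂ) (pd μ f x) := by
  unfold pd
  have := (Complex.conjCLE.toContinuousLinearMap.hasFDerivAt.comp x hf.hasFDerivAt).fderiv
  have e : (fun y => (starRingEnd ℂ) (f y)) = (Complex.conjCLE.toContinuousLinearMap : ℂ → ℂ) ∘ f := by
    funext y; simp
  rw [e, this]; simp

lemma pd_differentiable (hf : ContDiff ℝ (⊤ : ℕ∞) f) : Differentiable ℝ (pd μ f) := by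
  unfold pd
  have h1 : ContDiff ℝ 1 (fun x => fderiv ℝ f x) :=
    hf.fderiv_right (by norm_cast)
  exact (h1.differentiable (by norm_num)).clm_apply (differentiable_const _)

lemma conj_eta : (starRingEnd ℂ) (eta μ) = eta μ := by
  unfold eta; split_ifs <;> simp

lemma D_ne (z : ℂ) : 1 + z * (starRingEnd ℂ) z ≠ 0 := by
  rw [Complex.mul_conj]
  have : (0:ℝ) < 1 + Complex.normSq z := by have := Complex.normSq_nonneg z; linarith
  exact_mod_cast ne_of_gt this

/-- Contraction of a form whose only surviving coefficient is the mixed one. -/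
lemma contract {A B a b F : Fin (m + 1) → ℂ} (c1 c2 c3 c4 c5 : ℂ)
    (hA : ∑ μ, eta μ * A μ = 0) (hB : ∑ μ, eta μ * B μ = 0)
    (ha : ∑ μ, eta μ * a μ * a μ = 0) (hb : ∑ μ, eta μ * b μ * b μ = 0)
    (hF : ∀ μ, F μ = c1 * A μ + c2 * B μ + c3 * (a μ * a μ) + c4 * (a μ * b μ)
      + c5 * (b μ * b μ)) :
    ∑ μ, eta μ * F μ = c4 * ∑ μ, eta μ * (a μ * b μ) := by
  have : ∑ μ, eta μ * F μ = c1 * ∑ μ, eta μ * A μ + c2 * ∑ μ, eta μ * B μ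
      + c3 * ∑ μ, eta μ * a μ * a μ + c4 * ∑ μ, eta μ * (a μ * b μ)
      + c5 * ∑ μ, eta μ * b μ * b μ := by
    simp only [Finset.mul_sum, ← Finset.sum_add_distrib]
    refine Finset.sum_congr rfl fun μ _ => ?_
    rw [hF]; ring
  rw [this, hA, hB, ha, hb]; ring

end helpers

/-- First derivative of the projector. -/
lemma pdM_P {m : ℕ} (u v : Spacetime m → ℂ) (du : Differentiable ℝ u) (dv : Differentiable ℝ v)
    (h0 : ∀ y, 1 + u y * v y ≠ 0) (P : Spacetime m → Matrix (Fin 2) (Fin 2) ℂ)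
    (hP : ∀ x, P x = (1 + u x * v x)⁻¹ • !![1, v x; u x, u x * v x]) (μ : Fin (m + 1)) :
    pdM μ P = fun x => !![
      (0 - (pd μ u x * v x + u x * pd μ v x)) / ((1 + u x * v x) * (1 + u x * v x)),
      (pd μ v x - v x * v x * pd μ u x) / ((1 + u x * v x) * (1 + u x * v x));
      (pd μ u x - u x * u x * pd μ v x) / ((1 + u x * v x) * (1 + u x * v x)),
      (pd μ u x * v x + u x * pd μ v x) / ((1 + u x * v x) * (1 + u x * v x))] := by
  have e00 : (fun y => P y 0 0) = fun y => 1 / (1 + u y * v y) := by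
    funext y; rw [hP]; simp
  have e01 : (fun y => P y 0 1) = fun y => v y / (1 + u y * v y) := by
    funext y; rw [hP]; simp; ring
  have e10 : (fun y => P y 1 0) = fun y => u y / (1 + u y * v y) := by
    funext y; rw [hP]; simp; ring
  have e11 : (fun y => P y 1 1) = fun y => (u y * v y) / (1 + u y * v y) := by
    funext y; rw [hP]; simp; ring
  funext x
  have hx := h0 x
  have dD : DifferentiableAt ℝ (fun y => 1 + u y * v y) x := by fun_prop
  have pD : pd μ (fun y => 1 + u y * v y) x = pd μ u x * v x + u x * pd μ v x := by
    rw [pd_add' μ x (by fun_prop) (by fun_prop), pd_const', pd_mul' μ x (du x) (dv x), zero_add]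
  ext i j
  fin_cases i <;> fin_cases j <;> simp only [pdM, Matrix.of_apply, Fin.zero_eta, Fin.mk_one,
    Fin.isValue, Matrix.cons_val', Matrix.cons_val_zero, Matrix.cons_val_one,
    Matrix.cons_val_fin_one]
  · rw [e00, pd_div' μ x (by fun_prop) dD h0, pD, pd_const']
    field_simp
    ring
  · rw [e01, pd_div' μ x (by fun_prop) dD h0, pD]
    field_simp
    ring
  · rw [e10, pd_div' μ x (by fun_prop) dD h0, pD]
    field_simp
    ring
  · rw [e11, pd_div' μ x (by fun_prop) dD h0, pD, pd_mul' μ x (du x) (dv x)]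
    field_simp
    ring

/-- Second derivative of the projector. -/
lemma pdM_pdM_P {m : ℕ} (u v : Spacetime m → ℂ) (du : Differentiable ℝ u)
    (dv : Differentiable ℝ v) (μ : Fin (m + 1))
    (du' : Differentiable ℝ (pd μ u)) (dv' : Differentiable ℝ (pd μ v))
    (h0 : ∀ y, 1 + u y * v y ≠ 0) (P : Spacetime m → Matrix (Fin 2) (Fin 2) ℂ)
    (hP : ∀ x, P x = (1 + u x * v x)⁻¹ • !![1, v x; u x, u x * v x])
    (x : Spacetime m) (D a b A B : ℂ) (hD : D = 1 + u x * v x)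
    (ha : a = pd μ u x) (hb : b = pd μ v x)
    (hA : A = pd μ (pd μ u) x) (hB : B = pd μ (pd μ v) x) :
    pdM μ (pdM μ P) x = !![
      -(A * v x + 2 * a * b + u x * B) / D ^ 2 + 2 * (a * v x + u x * b) ^ 2 / D ^ 3,
      (B - 2 * v x * b * a - v x ^ 2 * A) / D ^ 2
        - 2 * (b - v x ^ 2 * a) * (a * v x + u x * b) / D ^ 3;
      (A - 2 * u x * a * b - u x ^ 2 * B) / D ^ 2
        - 2 * (a - u x ^ 2 * b) * (a * v x + u x * b) / D ^ 3,
      (A * v x + 2 * a * b + u x * B) / D ^ 2 - 2 * (a * v x + u x * b) ^ 2 / D ^ 3] := by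
  rw [pdM_P u v du dv h0 P hP μ]
  have hx := h0 x
  have hx' : D ≠ 0 := hD ▸ hx
  have dD : DifferentiableAt ℝ (fun y => 1 + u y * v y) x := by fun_prop
  have dDD : DifferentiableAt ℝ (fun y => (1 + u y * v y) * (1 + u y * v y)) x := by fun_prop
  have h00 : ∀ y, (1 + u y * v y) * (1 + u y * v y) ≠ 0 := fun y => mul_ne_zero (h0 y) (h0 y)
  have pD : pd μ (fun y => 1 + u y * v y) x = a * v x + u x * b := by
    rw [pd_add' μ x (by fun_prop) (by fun_prop), pd_const', pd_mul' μ x (du x) (dv x), zero_add,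
      ha, hb]
  have pDD : pd μ (fun y => (1 + u y * v y) * (1 + u y * v y)) x
      = 2 * D * (a * v x + u x * b) := by
    rw [pd_mul' μ x dD dD, pD, hD]; ring
  have pN : pd μ (fun y => pd μ u y * v y + u y * pd μ v y) x
      = A * v x + 2 * a * b + u x * B := by
    rw [pd_add' μ x (by fun_prop) (by fun_prop), pd_mul' μ x (du' x) (dv x),
      pd_mul' μ x (du x) (dv' x), ha, hb, hA, hB]; ring
  ext i j
  fin_cases i <;> fin_cases j <;> simp only [pdM, Matrix.of_apply, Fin.zero_eta, Fin.mk_one,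
    Fin.isValue, Matrix.cons_val', Matrix.cons_val_zero, Matrix.cons_val_one,
    Matrix.cons_val_fin_one]
  · rw [pd_div' μ x (by fun_prop) dDD h00, pDD, pd_sub' μ x (by fun_prop) (by fun_prop),
      pd_const', pN, ← hD, ← ha, ← hb]
    field_simp
    ring
  · rw [pd_div' μ x (by fun_prop) dDD h00, pDD, pd_sub' μ x (by fun_prop) (by fun_prop),
      pd_mul' μ x (by fun_prop) (by fun_prop), pd_mul' μ x (dv x) (dv x),
      ← hD, ← ha, ← hb, ← hA, ← hB]
    field_simp
    ring
  · rw [pd_div' μ x (by fun_prop) dDD h00, pDD, pd_sub' μ x (by fun_prop) (by fun_prop),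
      pd_mul' μ x (by fun_prop) (by fun_prop), pd_mul' μ x (du x) (du x),
      ← hD, ← ha, ← hb, ← hA, ← hB]
    field_simp
    ring
  · rw [pd_div' μ x (by fun_prop) dDD h00, pDD, pN, ← hD, ← ha, ← hb]
    field_simp

/-- If a smooth `u : M^{1+m} → ℂ` satisfies `□u = 0` and
`∂^μu ∂_μu = 0`, then `P = (1+|u|²)⁻¹ [[1, ū],[u, |u|²]]` satisfies the `ℂP¹`
submodel equations `[P, □P] = 0` and `[P,∂_μP] ⊗ ∂^μP + ∂^μP ⊗ [P,∂_μP] = 0`. -/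
theorem statement17 {m : ℕ} (u : Spacetime m → ℂ)
    (hu : ContDiff ℝ (⊤ : ℕ∞) u)
    (hbox : ∀ x, boxS u x = 0)
    (hnull : ∀ x, ∑ μ, eta μ * pd μ u x * pd μ u x = 0)
    (P : Spacetime m → Matrix (Fin 2) (Fin 2) ℂ)
    (hP : ∀ x, P x = (1 + u x * (starRingEnd ℂ) (u x))⁻¹ •
        !![1, (starRingEnd ℂ) (u x); u x, u x * (starRingEnd ℂ) (u x)]) :
    (∀ x, P x * boxM P x - boxM P x * P x = 0) ∧
    (∀ x, ∑ μ, eta μ •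
        ((P x * pdM μ P x - pdM μ P x * P x) ⊗ₖ pdM μ P x
          + pdM μ P x ⊗ₖ (P x * pdM μ P x - pdM μ P x * P x)) = 0) := by
  obtain ⟨v, hv⟩ : ∃ v : Spacetime m → ℂ, v = fun y => (starRingEnd ℂ) (u y) := ⟨_, rfl⟩
  have du : Differentiable ℝ u := hu.differentiable (by norm_num)
  have du' : ∀ μ, Differentiable ℝ (pd μ u) := fun μ => pd_differentiable μ hu
  have conjd : ∀ f : Spacetime m → ℂ, Differentiable ℝ f →
      Differentiable ℝ (fun y => (starRingEnd ℂ) (f y)) := fun f hf =>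
    Complex.conjCLE.toContinuousLinearMap.differentiable.comp hf
  have dv : Differentiable ℝ v := hv ▸ conjd u du
  have pv : ∀ μ, pd μ v = fun y => (starRingEnd ℂ) (pd μ u y) := fun μ => by
    funext y; rw [hv]; exact pd_conj' μ y (du y)
  have dv' : ∀ μ, Differentiable ℝ (pd μ v) := fun μ => by
    rw [pv]; exact conjd _ (du' μ)
  have ppv : ∀ μ y, pd μ (pd μ v) y = (starRingEnd ℂ) (pd μ (pd μ u) y) := fun μ y => by
    rw [pv]; exact pd_conj' μ y (du' μ y)
  have h0 : ∀ y, 1 + u y * v y ≠ 0 := fun y => by rw [hv]; exact D_ne (u y)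
  have hP' : ∀ x, P x = (1 + u x * v x)⁻¹ • !![1, v x; u x, u x * v x] := fun x => by
    rw [hP x, hv]
  have nu := hnull
  have nv : ∀ x, ∑ μ, eta μ * pd μ v x * pd μ v x = 0 := fun x => by
    have := congrArg (starRingEnd ℂ) (hnull x)
    simpa [map_sum, conj_eta, pv] using this
  have bu : ∀ x, ∑ μ, eta μ * pd μ (pd μ u) x = 0 := hbox
  have bv : ∀ x, ∑ μ, eta μ * pd μ (pd μ v) x = 0 := fun x => by
    have := congrArg (starRingEnd ℂ) (bu x)
    simpa [map_sum, conj_eta, ppv] using this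
  clear hbox hnull hP
  constructor
  · intro x
    obtain ⟨s, hs⟩ : ∃ s, s = ∑ μ, eta μ * (pd μ u x * pd μ v x) := ⟨_, rfl⟩
    have hx := h0 x
    obtain ⟨D, hD⟩ : ∃ D, D = 1 + u x * v x := ⟨_, rfl⟩
    have hD0 : D ≠ 0 := hD ▸ hx
    have key : boxM P x = (s / D ^ 3) • !![2 * (u x * v x) - 2, -4 * v x;
        -4 * u x, 2 - 2 * (u x * v x)] := by
      have e : boxM P x = ∑ μ, eta μ • pdM μ (pdM μ P) x := rfl
      rw [e]
      simp only [fun μ => pdM_pdM_P u v du dv μ (du' μ) (dv' μ) h0 P hP' x D _ _ _ _ hD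
        rfl rfl rfl rfl]
      have C := fun F c1 c2 c3 c4 c5 => contract (F := F) c1 c2 c3 c4 c5 (bu x) (bv x) (nu x) (nv x)
      simp only [← hs] at C
      ext i j
      rw [Matrix.sum_apply]
      fin_cases i <;> fin_cases j <;> simp only [Matrix.smul_apply, smul_eq_mul, Matrix.of_apply,
        Fin.zero_eta, Fin.mk_one, Fin.isValue, Matrix.cons_val', Matrix.cons_val_zero,
        Matrix.cons_val_one, Matrix.cons_val_fin_one]
      · rw [C _ (-v x / D ^ 2) (-u x / D ^ 2) (2 * v x ^ 2 / D ^ 3)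
          (-2 / D ^ 2 + 4 * u x * v x / D ^ 3) (2 * u x ^ 2 / D ^ 3) (fun μ => by ring)]
        field_simp
        rw [hD]; ring
      · rw [C _ (-v x ^ 2 / D ^ 2) (1 / D ^ 2) (2 * v x ^ 3 / D ^ 3)
          (-2 * v x / D ^ 2 - 2 * (v x - v x ^ 2 * u x) / D ^ 3) (-2 * u x / D ^ 3)
          (fun μ => by ring)]
        field_simp
        rw [hD]; ring
      · rw [C _ (1 / D ^ 2) (-u x ^ 2 / D ^ 2) (-2 * v x / D ^ 3)
          (-2 * u x / D ^ 2 - 2 * (u x - u x ^ 2 * v x) / D ^ 3) (2 * u x ^ 3 / D ^ 3)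
          (fun μ => by ring)]
        field_simp
        rw [hD]; ring
      · rw [C _ (v x / D ^ 2) (u x / D ^ 2) (-2 * v x ^ 2 / D ^ 3)
          (2 / D ^ 2 - 4 * u x * v x / D ^ 3) (-2 * u x ^ 2 / D ^ 3) (fun μ => by ring)]
        field_simp
        rw [hD]; ring
    rw [key, hP' x]
    ext i j
    fin_cases i <;> fin_cases j <;> simp [Matrix.mul_apply, Fin.sum_univ_two] <;> ring
  · intro x
    have hx := h0 x
    obtain ⟨D, hD⟩ : ∃ D, D = 1 + u x * v x := ⟨_, rfl⟩
    have hD0 : D ≠ 0 := hD ▸ hx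
    obtain ⟨X, hX⟩ : ∃ X : Matrix (Fin 2) (Fin 2) ℂ,
      X = (D ^ 2)⁻¹ • !![-v x, -v x ^ 2; 1, v x] := ⟨_, rfl⟩
    obtain ⟨Y, hY⟩ : ∃ Y : Matrix (Fin 2) (Fin 2) ℂ,
      Y = (D ^ 2)⁻¹ • !![-u x, 1; -u x ^ 2, u x] := ⟨_, rfl⟩
    have h1 : ∀ μ, pdM μ P x = pd μ u x • X + pd μ v x • Y := fun μ => by
      rw [pdM_P u v du dv h0 P hP' μ, hX, hY]
      beta_reduce
      rw [← hD]
      ext i j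
      fin_cases i <;> fin_cases j <;> simp <;> field_simp <;> ring
    have hPX : P x * X = 0 := by
      rw [hP' x, hX]
      ext i j
      fin_cases i <;> fin_cases j <;> simp [Matrix.mul_apply, Fin.sum_univ_two] <;> ring
    have hYP : Y * P x = 0 := by
      rw [hP' x, hY]
      ext i j
      fin_cases i <;> fin_cases j <;> simp [Matrix.mul_apply, Fin.sum_univ_two] <;> ring
    have hXP : X * P x = X := by
      rw [hP' x, hX, ← hD]
      ext i j
      fin_cases i <;> fin_cases j <;> simp [Matrix.mul_apply, Fin.sum_univ_two] <;>
        field_simp <;> rw [hD] <;> ring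
    have hPY : P x * Y = Y := by
      rw [hP' x, hY, ← hD]
      ext i j
      fin_cases i <;> fin_cases j <;> simp [Matrix.mul_apply, Fin.sum_univ_two] <;>
        field_simp <;> rw [hD] <;> ring
    have h2 : ∀ μ, P x * pdM μ P x - pdM μ P x * P x = pd μ v x • Y - pd μ u x • X := fun μ => by
      rw [h1]
      simp [mul_add, add_mul, hPX, hYP, hXP, hPY]
    simp only [h2]
    simp only [h1]
    ext ⟨i, j⟩ ⟨k, l⟩
    rw [Matrix.sum_apply]
    simp only [Matrix.smul_apply, Matrix.add_apply, Matrix.sub_apply, Matrix.kroneckerMap_apply,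
      smul_eq_mul, Matrix.zero_apply]
    have n1 : ∑ μ, eta μ * (pd μ u x * pd μ u x) = 0 := by
      simpa only [mul_assoc] using nu x
    have n2 : ∑ μ, eta μ * (pd μ v x * pd μ v x) = 0 := by
      simpa only [mul_assoc] using nv x
    have tot : (-2 * (X i k * X j l)) * (∑ μ, eta μ * (pd μ u x * pd μ u x))
        + (2 * (Y i k * Y j l)) * (∑ μ, eta μ * (pd μ v x * pd μ v x)) = 0 := by
      rw [n1, n2]; ring
    rw [← tot, Finset.mul_sum, Finset.mul_sum, ← Finset.sum_add_distrib]
    refine Finset.sum_congr rfl fun μ _ => ?_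
    ring
end
end
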